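/- L^p-Euclidean Nash inequality: Let p > 1, q = p/(p-1), n ≥ 1, and let g : ℝⁿ → (0,∞) be a C¹ positive function with g ∈ L¹ ∩ L^p and ∇g ∈ L^p. Then ( ∫_{ℝⁿ} g^p dx )^{1 + q/n} ≤ p^p γ_{n,p}^{-1} ( ∫_{ℝⁿ} g dx )^{pq/n} ∫_{ℝⁿ} |∇g|^p dx, where γ_{n,p} = n (q e)^{p-1} π^{p/2} [ Γ(n/2+1)/Γ(n/q+1) ]^{-p/n}. -/

import Mathlib

open MeasureTheory


/-- The sharp constant `γ_{n,p} = n (q e)^{p-1} π^{p/2} (Γ(n/2+1)/Γ(n/q+1))^{-p/n}`. -/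
noncomputable def gammaConst (n : ℕ) (p q : ℝ) : ℝ :=
  (n : ℝ) * (q * Real.exp 1) ^ (p - 1) * Real.pi ^ (p / 2) *
    (Real.Gamma ((n : ℝ) / 2 + 1) / Real.Gamma ((n : ℝ) / q + 1)) ^ (-(p / (n : ℝ)))

open scoped ENNReal

theorem IsCompact.volume_add_volume_le_of_add_mem {K L C : Set ℝ} (hK : IsCompact K)
    (hL : IsCompact L) (hK0 : K.Nonempty) (hL0 : L.Nonempty)
    (h : ∀ a ∈ K, ∀ b ∈ L, a + b ∈ C) : volume K + volume L ≤ volume C := by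
  set a := sSup K
  set b := sInf L
  have ha : a ∈ K := hK.sSup_mem hK0
  have hb : b ∈ L := hL.sInf_mem hL0
  set S : Set ℝ := (fun x => x + -b) ⁻¹' K
  set T : Set ℝ := (fun x => x + -a) ⁻¹' L
  have hT : MeasurableSet T := (measurable_add_const (-a)) hL.measurableSet
  have hdisj : AEDisjoint volume S T := by
    refine measure_mono_null (t := {a + b}) ?_ (by simp)
    rintro x ⟨hx1, hx2⟩
    have h1 : x + -b ≤ a := le_csSup hK.bddAbove hx1
    have h2 : b ≤ x + -a := csInf_le hL.bddBelow hx2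
    simp only [Set.mem_singleton_iff]
    linarith
  calc volume K + volume L = volume S + volume T := by
        rw [measure_preimage_add_right, measure_preimage_add_right]
    _ = volume (S ∪ T) := (measure_union₀ hT.nullMeasurableSet hdisj).symm
    _ ≤ volume C := by
        refine measure_mono ?_
        rintro x (hx | hx)
        · simpa using h _ hx _ hb
        · simpa using h _ ha _ hx

/-- The Brunn–Minkowski inequality on the real line. -/
theorem volume_add_volume_le_of_add_mem {A B C : Set ℝ} (hA : MeasurableSet A)
    (hB : MeasurableSet B) (hA0 : A.Nonempty) (hB0 : B.Nonempty)
    (h : ∀ a ∈ A, ∀ b ∈ B, a + b ∈ C) : volume A + volume B ≤ volume C := by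
  obtain ⟨a, ha⟩ := hA0
  obtain ⟨b, hb⟩ := hB0
  have key : ∀ K ⊆ A, IsCompact K → ∀ L ⊆ B, IsCompact L →
      volume K + volume L ≤ volume C := by
    intro K hKA hK L hLB hL
    calc volume K + volume L ≤ volume (insert a K) + volume (insert b L) := by
          gcongr <;> exact Set.subset_insert _ _
      _ ≤ volume C := (hK.insert a).volume_add_volume_le_of_add_mem (hL.insert b)
          (Set.insert_nonempty _ _) (Set.insert_nonempty _ _) fun x hx y hy =>
            h x (Set.insert_subset ha hKA hx) y (Set.insert_subset hb hLB hy)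
  refine ENNReal.le_of_forall_pos_le_add fun ε hε hC => ?_
  have hε2 : ((ε : ℝ≥0∞) / 2) ≠ 0 := by simp [hε.ne']
  have hAtop : volume A ≠ ∞ := by
    refine ((hA.measure_eq_iSup_isCompact (μ := volume)).le.trans ?_).trans_lt hC |>.ne
    refine iSup₂_le fun K hKA => iSup_le fun hK => ?_
    simpa using key K hKA hK ∅ (Set.empty_subset _) isCompact_empty
  have hBtop : volume B ≠ ∞ := by
    refine ((hB.measure_eq_iSup_isCompact (μ := volume)).le.trans ?_).trans_lt hC |>.ne
    refine iSup₂_le fun K hKA => iSup_le fun hK => ?_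
    simpa using key ∅ (Set.empty_subset _) isCompact_empty K hKA hK
  obtain ⟨K, hKA, hK, hKm⟩ := hA.exists_isCompact_lt_add hAtop hε2
  obtain ⟨L, hLB, hL, hLm⟩ := hB.exists_isCompact_lt_add hBtop hε2
  calc volume A + volume B ≤ (volume K + ε / 2) + (volume L + ε / 2) := by gcongr
    _ = (volume K + volume L) + ε := by
        rw [add_add_add_comm, ENNReal.add_halves]
    _ ≤ volume C + ε := by gcongr; exact key K hKA hK L hLB hL

/-- One-dimensional Prékopa–Leindler inequality, in additive form, for functions with
supremum `1`. -/
theorem lintegral_add_le_of_iSup_eq_one {t : ℝ} (ht0 : 0 < t) (ht1 : t < 1) {f k h : ℝ → ℝ≥0∞}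
    (hf : Measurable f) (hk : Measurable k) (hh : Measurable h)
    (hf1 : ⨆ x, f x = 1) (hk1 : ⨆ x, k x = 1)
    (hfk : ∀ x y, f x ^ (1 - t) * k y ^ t ≤ h ((1 - t) * x + t * y)) :
    ENNReal.ofReal (1 - t) * (∫⁻ x, f x) + ENNReal.ofReal t * (∫⁻ x, k x) ≤ ∫⁻ x, h x := by
  have layer : ∀ u : ℝ → ℝ≥0∞, Measurable u → (∀ x, u x ≤ 1) →
      ∫⁻ x, u x = ∫⁻ s in Set.Ioo (0 : ℝ) 1, volume {x | ENNReal.ofReal s < u x} := by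
    intro u hu hu1
    have hfin : ∀ x, u x ≠ ∞ := fun x => ((hu1 x).trans_lt ENNReal.one_lt_top).ne
    have e1 : ∫⁻ x, u x = ∫⁻ x, ENNReal.ofReal (u x).toReal :=
      lintegral_congr fun x => (ENNReal.ofReal_toReal (hfin x)).symm
    rw [e1, lintegral_eq_lintegral_meas_lt _ (ae_of_all _ fun x => ENNReal.toReal_nonneg)
      hu.ennreal_toReal.aemeasurable]
    have e2 : ∀ s ∈ Set.Ioi (0 : ℝ), volume {x | s < (u x).toReal}
        = (Set.Ioo (0 : ℝ) 1).indicator (fun s => volume {x | ENNReal.ofReal s < u x}) s := by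
      intro s hs
      by_cases hs1 : s < 1
      · rw [Set.indicator_of_mem (show s ∈ Set.Ioo (0 : ℝ) 1 from ⟨hs, hs1⟩)]
        congr 1
        ext x
        simp only [Set.mem_ofPred_eq]
        rw [ENNReal.ofReal_lt_iff_lt_toReal (le_of_lt hs) (hfin x)]
      · rw [Set.indicator_of_notMem (fun h => hs1 h.2)]
        convert! measure_empty (μ := (volume : Measure ℝ))
        ext x
        simp only [Set.mem_ofPred_eq, Set.mem_empty_iff_false, iff_false, not_lt]
        exact (ENNReal.toReal_mono ENNReal.one_ne_top (hu1 x)).trans (by simpa using hs1)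
    rw [setLIntegral_congr_fun measurableSet_Ioi e2, lintegral_indicator measurableSet_Ioo,
      Measure.restrict_restrict measurableSet_Ioo]
    congr 2
    exact Set.inter_eq_left.2 fun x hx => hx.1
  have hfle : ∀ x, f x ≤ 1 := fun x => hf1 ▸ le_iSup f x
  have hkle : ∀ x, k x ≤ 1 := fun x => hk1 ▸ le_iSup k x
  have hmeas : ∀ u : ℝ → ℝ≥0∞, Measurable fun s : ℝ => volume {x | ENNReal.ofReal s < u x} := by
    intro u
    refine Antitone.measurable fun a b hab => measure_mono fun x hx => ?_
    exact (ENNReal.ofReal_le_ofReal hab).trans_lt hx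
  have ht' : 0 < 1 - t := by linarith
  have hscale : ∀ (r : ℝ), 0 < r → ∀ A : Set ℝ,
      ENNReal.ofReal r * volume A = volume ((fun x => r⁻¹ * x) ⁻¹' A) := by
    intro r hr A
    rw [Real.volume_preimage_mul_left (inv_ne_zero hr.ne'), inv_inv, abs_of_pos hr]
  have hlevel : ∀ s ∈ Set.Ioo (0 : ℝ) 1,
      ENNReal.ofReal (1 - t) * volume {x | ENNReal.ofReal s < f x} +
        ENNReal.ofReal t * volume {x | ENNReal.ofReal s < k x} ≤
      volume {x | ENNReal.ofReal s < min (h x) 1} := by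
    intro s hs
    have hs1 : ENNReal.ofReal s < 1 := by simpa using hs.2
    rw [hscale _ ht', hscale _ ht0]
    refine volume_add_volume_le_of_add_mem ?_ ?_ ?_ ?_ ?_
    · exact (measurable_const_mul _) (measurableSet_lt measurable_const hf)
    · exact (measurable_const_mul _) (measurableSet_lt measurable_const hk)
    · obtain ⟨x, hx⟩ := lt_iSup_iff.1 (hf1.symm ▸ hs1)
      exact ⟨(1 - t) * x, by simpa [ht'.ne'] using hx⟩
    · obtain ⟨x, hx⟩ := lt_iSup_iff.1 (hk1.symm ▸ hs1)
      exact ⟨t * x, by simpa [ht0.ne'] using hx⟩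
    · intro a ha b hb
      simp only [Set.mem_preimage, Set.mem_ofPred_eq] at ha hb ⊢
      refine lt_min ?_ hs1
      have := hfk ((1 - t)⁻¹ * a) (t⁻¹ * b)
      rw [mul_inv_cancel_left₀ ht'.ne', mul_inv_cancel_left₀ ht0.ne'] at this
      refine lt_of_lt_of_le ?_ this
      have hs0 : ENNReal.ofReal s ≠ 0 := by simpa using hs.1
      calc ENNReal.ofReal s = ENNReal.ofReal s ^ (1 - t) * ENNReal.ofReal s ^ t := by
            rw [← ENNReal.rpow_add _ _ hs0 ENNReal.ofReal_ne_top]; simp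
        _ < _ := ENNReal.mul_lt_mul (ENNReal.rpow_lt_rpow ha ht') (ENNReal.rpow_lt_rpow hb ht0)
  calc ENNReal.ofReal (1 - t) * (∫⁻ x, f x) + ENNReal.ofReal t * (∫⁻ x, k x)
      = ∫⁻ s in Set.Ioo (0 : ℝ) 1, (ENNReal.ofReal (1 - t) * volume {x | ENNReal.ofReal s < f x} +
        ENNReal.ofReal t * volume {x | ENNReal.ofReal s < k x}) := by
        rw [layer f hf hfle, layer k hk hkle, lintegral_add_left ((hmeas f).const_mul _),
          lintegral_const_mul _ (hmeas f), lintegral_const_mul _ (hmeas k)]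
    _ ≤ ∫⁻ s in Set.Ioo (0 : ℝ) 1, volume {x | ENNReal.ofReal s < min (h x) 1} :=
        setLIntegral_mono (hmeas _) hlevel
    _ = ∫⁻ x, min (h x) 1 := (layer _ (hh.min measurable_const) fun x => min_le_right _ _).symm
    _ ≤ ∫⁻ x, h x := lintegral_mono fun x => min_le_left _ _

/-- Weighted arithmetic-geometric mean inequality in `ℝ≥0∞`. -/
theorem ENNReal.rpow_mul_rpow_le_add {t : ℝ} (ht0 : 0 < t) (ht1 : t < 1) (a b : ℝ≥0∞) :
    a ^ (1 - t) * b ^ t ≤ ENNReal.ofReal (1 - t) * a + ENNReal.ofReal t * b := by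
  have ht' : 0 < 1 - t := by linarith
  rcases eq_or_ne a ∞ with rfl | ha
  · rw [ENNReal.mul_top (by simpa using ht1), top_add]
    exact le_top
  rcases eq_or_ne b ∞ with rfl | hb
  · rw [ENNReal.mul_top (by simpa using ht0), add_top]
    exact le_top
  lift a to NNReal using ha
  lift b to NNReal using hb
  have := NNReal.geom_mean_le_arith_mean2_weighted (1 - t).toNNReal t.toNNReal a b
    (by rw [← Real.toNNReal_add ht'.le ht0.le]; simp)
  rw [Real.coe_toNNReal _ ht'.le, Real.coe_toNNReal _ ht0.le] at this
  rw [← ENNReal.coe_rpow_of_nonneg _ ht'.le, ← ENNReal.coe_rpow_of_nonneg _ ht0.le,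
    ENNReal.ofReal, ENNReal.ofReal]
  exact_mod_cast this

theorem prekopa_leindler_real_of_bounded {t : ℝ} (ht0 : 0 < t) (ht1 : t < 1) {f k h : ℝ → ℝ≥0∞}
    (hf : Measurable f) (hk : Measurable k) (hh : Measurable h)
    (hf1 : ⨆ x, f x ≠ ∞) (hk1 : ⨆ x, k x ≠ ∞)
    (hfk : ∀ x y, f x ^ (1 - t) * k y ^ t ≤ h ((1 - t) * x + t * y)) :
    (∫⁻ x, f x) ^ (1 - t) * (∫⁻ x, k x) ^ t ≤ ∫⁻ x, h x := by
  have ht' : 0 < 1 - t := by linarith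
  set α := ⨆ x, f x
  set β := ⨆ x, k x
  rcases eq_or_ne α 0 with hα | hα
  · have : ∀ x, f x = 0 := by simpa [α] using hα
    simp [this, ht']
  rcases eq_or_ne β 0 with hβ | hβ
  · have : ∀ x, k x = 0 := by simpa [β] using hβ
    simp [this, ht0]
  set γ := α ^ (1 - t) * β ^ t
  have hγ0 : γ ≠ 0 := mul_ne_zero (by simp [hα, hf1]) (by simp [hβ, hk1])
  have hγt : γ ≠ ∞ := ENNReal.mul_ne_top (ENNReal.rpow_ne_top_of_nonneg ht'.le hf1)
    (ENNReal.rpow_ne_top_of_nonneg ht0.le hk1)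
  have hγi : (α⁻¹) ^ (1 - t) * (β⁻¹) ^ t = γ⁻¹ := by
    rw [ENNReal.inv_rpow, ENNReal.inv_rpow, ENNReal.mul_inv]
    · left; simp [hα, hf1]
    · left; exact ENNReal.rpow_ne_top_of_nonneg ht'.le hf1
  have key := lintegral_add_le_of_iSup_eq_one ht0 ht1 (f := fun x => α⁻¹ * f x)
    (k := fun x => β⁻¹ * k x) (h := fun x => γ⁻¹ * h x) (hf.const_mul _) (hk.const_mul _)
    (hh.const_mul _) (by rw [← ENNReal.mul_iSup]; exact ENNReal.inv_mul_cancel hα hf1)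
    (by rw [← ENNReal.mul_iSup]; exact ENNReal.inv_mul_cancel hβ hk1) (by
      intro x y
      rw [ENNReal.mul_rpow_of_nonneg _ _ ht'.le, ENNReal.mul_rpow_of_nonneg _ _ ht0.le,
        mul_mul_mul_comm, hγi]
      gcongr
      exact hfk x y)
  have := (ENNReal.rpow_mul_rpow_le_add ht0 ht1 _ _).trans key
  rw [lintegral_const_mul _ hf, lintegral_const_mul _ hk, lintegral_const_mul _ hh,
    ENNReal.mul_rpow_of_nonneg _ _ ht'.le, ENNReal.mul_rpow_of_nonneg _ _ ht0.le,
        mul_mul_mul_comm, hγi] at this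
  exact (ENNReal.mul_le_mul_iff_right (ENNReal.inv_ne_zero.2 hγt) (ENNReal.inv_ne_top.2 hγ0)).1 this

/-- The Prékopa–Leindler inequality on the real line. -/
theorem prekopa_leindler_real {t : ℝ} (ht0 : 0 < t) (ht1 : t < 1) {f k h : ℝ → ℝ≥0∞}
    (hf : Measurable f) (hk : Measurable k) (hh : Measurable h)
    (hfk : ∀ x y, f x ^ (1 - t) * k y ^ t ≤ h ((1 - t) * x + t * y)) :
    (∫⁻ x, f x) ^ (1 - t) * (∫⁻ x, k x) ^ t ≤ ∫⁻ x, h x := by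
  have ht' : 0 < 1 - t := by linarith
  have trunc : ∀ u : ℝ → ℝ≥0∞, Measurable u →
      ∫⁻ x, u x = ⨆ m : ℕ, ∫⁻ x, min (u x) m := by
    intro u hu
    rw [← lintegral_iSup (fun m => hu.min measurable_const)
      (fun a b hab x => min_le_min_left _ (by exact_mod_cast hab))]
    refine lintegral_congr fun x => ?_
    rw [← inf_iSup_eq, ENNReal.iSup_natCast, inf_top_eq]
  have hpow : ∀ (r : ℝ), 0 < r → ∀ u : ℕ → ℝ≥0∞, (⨆ m, u m) ^ r = ⨆ m, u m ^ r :=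
    fun r hr u => (ENNReal.orderIsoRpow r hr).map_iSup u
  rw [trunc f hf, trunc k hk, hpow _ ht', hpow _ ht0, ENNReal.iSup_mul]
  refine iSup_le fun m => ?_
  rw [ENNReal.mul_iSup]
  refine iSup_le fun m' => ?_
  have hbdd : ∀ (u : ℝ → ℝ≥0∞) (l : ℕ), ⨆ x, min (u x) (l : ℝ≥0∞) ≠ ∞ := fun u l =>
    ((iSup_le fun x => min_le_right _ _).trans_lt (ENNReal.natCast_lt_top l)).ne
  refine prekopa_leindler_real_of_bounded ht0 ht1 (hf.min measurable_const)
    (hk.min measurable_const) hh (hbdd f m) (hbdd k m') fun x y => le_trans ?_ (hfk x y)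
  gcongr <;> exact min_le_left _ _

/-- The Prékopa–Leindler inequality on `Fin n → ℝ`. -/
theorem prekopa_leindler_pi {t : ℝ} (ht0 : 0 < t) (ht1 : t < 1) (n : ℕ)
    {f k h : (Fin n → ℝ) → ℝ≥0∞} (hf : Measurable f) (hk : Measurable k) (hh : Measurable h)
    (hfk : ∀ x y, f x ^ (1 - t) * k y ^ t ≤ h ((1 - t) • x + t • y)) :
    (∫⁻ x, f x) ^ (1 - t) * (∫⁻ x, k x) ^ t ≤ ∫⁻ x, h x := by
  induction n with
  | zero =>
    have hvol : (volume : Measure (Fin 0 → ℝ)) = Measure.dirac default :=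
      Measure.pi_of_empty (fun _ => volume) default
    rw [hvol, lintegral_dirac, lintegral_dirac, lintegral_dirac]
    exact (hfk default default).trans_eq (congrArg h (Subsingleton.elim _ _))
  | succ n ih =>
    set e := MeasurableEquiv.piFinSuccAbove (fun _ : Fin (n + 1) => ℝ) 0
    have he : MeasurePreserving e.symm volume volume :=
      (volume_preserving_piFinSuccAbove (fun _ : Fin (n + 1) => ℝ) 0).symm _
    have slice : ∀ u : (Fin (n + 1) → ℝ) → ℝ≥0∞, Measurable u →
        ∫⁻ x, u x = ∫⁻ a, ∫⁻ v, u (e.symm (a, v)) := by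
      intro u hu
      rw [← he.lintegral_comp hu, Measure.volume_eq_prod, lintegral_prod]
      exact (hu.comp e.symm.measurable).aemeasurable
    have hsm : ∀ u : (Fin (n + 1) → ℝ) → ℝ≥0∞, Measurable u →
        Measurable fun a => ∫⁻ v, u (e.symm (a, v)) := fun u hu =>
      (hu.comp e.symm.measurable).lintegral_prod_right'
    rw [slice f hf, slice k hk, slice h hh]
    refine prekopa_leindler_real ht0 ht1 (hsm f hf) (hsm k hk) (hsm h hh) fun a b => ?_
    have hm : ∀ (u : (Fin (n + 1) → ℝ) → ℝ≥0∞) (a : ℝ), Measurable u →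
        Measurable fun v => u (e.symm (a, v)) := fun u a hu =>
      (hu.comp e.symm.measurable).comp measurable_prodMk_left
    refine ih (hm f a hf) (hm k b hk) (hm h _ hh) fun v w => (hfk _ _).trans_eq ?_
    congr 1
    ext i
    refine Fin.cases ?_ (fun j => ?_) i <;> simp [e, MeasurableEquiv.piFinSuccAbove]

/-- The Prékopa–Leindler inequality on Euclidean space. -/
theorem prekopa_leindler {t : ℝ} (ht0 : 0 < t) (ht1 : t < 1) {n : ℕ}
    {f k h : EuclideanSpace ℝ (Fin n) → ℝ≥0∞} (hf : Measurable f) (hk : Measurable k)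
    (hh : Measurable h)
    (hfk : ∀ x y, f x ^ (1 - t) * k y ^ t ≤ h ((1 - t) • x + t • y)) :
    (∫⁻ x, f x) ^ (1 - t) * (∫⁻ x, k x) ^ t ≤ ∫⁻ x, h x := by
  have hE := PiLp.volume_preserving_toLp (Fin n)
  rw [← hE.lintegral_comp hf, ← hE.lintegral_comp hk, ← hE.lintegral_comp hh]
  exact prekopa_leindler_pi ht0 ht1 n (hf.comp hE.measurable) (hk.comp hE.measurable)
    (hh.comp hE.measurable) fun x y => (hfk _ _).trans_eq (by simp)

/-- Explicit upper bound for the Hopf–Lax type supremum `sup_y G (w - s y) exp (-s (lam |y|)^q / q)`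
in terms of the values `g = G w` and `a = A w`, where `A` controls the increments of `G`. -/
noncomputable def hopfLaxBound (p lam L R s g a : ℝ) : ℝ :=
  g * Real.exp (s * min ((L / lam) ^ p / p) ((Real.exp (L * s * R) * a / g / lam) ^ p / p))

theorem mul_exp_le_hopfLaxBound {p q lam L R s g a r u : ℝ} (hpq : p.HolderConjugate q)
    (hlam : 0 < lam) (hL : 0 ≤ L) (hs : 0 ≤ s) (hg : 0 < g) (ha : 0 ≤ a) (hr : 0 ≤ r)
    (hR : ∀ r, R ≤ r → L * r ≤ (lam * r) ^ q / q)
    (hu1 : u ≤ Real.exp (L * (s * r)) * g)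
    (hu2 : u ≤ g + s * r * Real.exp (L * (s * r)) * a) :
    u * Real.exp (-(s * ((lam * r) ^ q / q))) ≤ hopfLaxBound p lam L R s g a := by
  have young : ∀ b, 0 ≤ b → b * r ≤ (b / lam) ^ p / p + (lam * r) ^ q / q := by
    intro b hb
    have := Real.young_inequality_of_nonneg (a := b / lam) (b := lam * r) (by positivity)
      (by positivity) hpq
    calc b * r = b / lam * (lam * r) := by field_simp
      _ ≤ _ := this
  have hp := hpq.pos
  have hq := hpq.symm.pos
  have b1 : u * Real.exp (-(s * ((lam * r) ^ q / q))) ≤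
      g * Real.exp (s * (L * r - (lam * r) ^ q / q)) := by
    calc _ ≤ Real.exp (L * (s * r)) * g * Real.exp (-(s * ((lam * r) ^ q / q))) := by gcongr
      _ = _ := by
        rw [mul_comm (Real.exp _) g, mul_assoc, ← Real.exp_add]
        ring_nf
  unfold hopfLaxBound
  rcases le_total R r with hRr | hRr
  · refine b1.trans ?_
    gcongr
    refine (sub_nonpos.2 (hR r hRr)).trans ?_
    positivity
  · have b2 : u * Real.exp (-(s * ((lam * r) ^ q / q))) ≤
        g * Real.exp (s * ((Real.exp (L * s * R) * a / g / lam) ^ p / p)) := by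
      set b := Real.exp (L * s * R) * a / g with hb
      have hb0 : 0 ≤ b := by positivity
      have hub : u ≤ g * Real.exp (s * (b * r)) := by
        calc u ≤ g + s * r * Real.exp (L * (s * r)) * a := hu2
          _ ≤ g + s * r * Real.exp (L * s * R) * a := by
            rw [← mul_assoc L]
            gcongr
          _ = g * (s * (b * r) + 1) := by rw [hb]; field_simp; ring
          _ ≤ g * Real.exp (s * (b * r)) := by
            gcongr; exact Real.add_one_le_exp _
      calc _ ≤ g * Real.exp (s * (b * r)) * Real.exp (-(s * ((lam * r) ^ q / q))) := by gcongr
        _ = g * Real.exp (s * (b * r - (lam * r) ^ q / q)) := by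
          rw [mul_assoc, ← Real.exp_add]
          ring_nf
        _ ≤ _ := by
          gcongr
          linarith [young b hb0]
    rcases min_choice ((L / lam) ^ p / p) ((Real.exp (L * s * R) * a / g / lam) ^ p / p)
      with h | h <;> rw [h]
    · refine b1.trans ?_
      gcongr
      linarith [young L hL]
    · exact b2

theorem hopfLaxBound_le {p lam L R s g a : ℝ} (hs : 0 ≤ s) (hg : 0 ≤ g) :
    hopfLaxBound p lam L R s g a ≤ Real.exp (s * ((L / lam) ^ p / p)) * g := by
  rw [hopfLaxBound, mul_comm]
  gcongr
  exact min_le_left _ _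

theorem hopfLaxBound_pos {p lam L R s g a : ℝ} (hg : 0 < g) : 0 < hopfLaxBound p lam L R s g a :=
  mul_pos hg (Real.exp_pos _)

theorem hopfLaxBound_rpow_le {p lam L R s g a : ℝ} (hp : 0 < p) (hlam : 0 < lam) (hL : 0 ≤ L)
    (hs : 0 ≤ s) (hg : 0 < g) (ha : 0 ≤ a) :
    hopfLaxBound p lam L R s g a ^ p ≤
      g ^ p + s * lam ^ (-p) * Real.exp (s * ((L / lam) ^ p + p * L * R)) * a ^ p := by
  set m := min ((L / lam) ^ p / p) ((Real.exp (L * s * R) * a / g / lam) ^ p / p) with hm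
  have hm0 : 0 ≤ m := by positivity
  have e1 : p * m ≤ (L / lam) ^ p := by
    rw [← le_div_iff₀' hp]; exact min_le_left _ _
  have e2 : p * m ≤ (Real.exp (L * s * R) * a / g / lam) ^ p := by
    rw [← le_div_iff₀' hp]; exact min_le_right _ _
  have e3 : (Real.exp (L * s * R) * a / g / lam) ^ p =
      Real.exp (s * (p * L * R)) * a ^ p * lam ^ (-p) / g ^ p := by
    rw [Real.div_rpow (by positivity) hlam.le, Real.div_rpow (by positivity) hg.le,
      Real.mul_rpow (Real.exp_pos _).le ha, ← Real.exp_mul, Real.rpow_neg hlam.le]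
    ring_nf
  have e4 : ∀ x : ℝ, Real.exp x ≤ 1 + x * Real.exp x := by
    intro x
    have h1 := Real.add_one_le_exp (-x)
    have h2 := Real.exp_pos x
    have h3 : Real.exp (-x) * Real.exp x = 1 := by rw [← Real.exp_add]; simp
    nlinarith
  calc hopfLaxBound p lam L R s g a ^ p = g ^ p * Real.exp (s * (p * m)) := by
        rw [hopfLaxBound, ← hm, Real.mul_rpow hg.le (Real.exp_pos _).le, ← Real.exp_mul]
        ring_nf
    _ ≤ g ^ p * (1 + s * (p * m) * Real.exp (s * (p * m))) := by
        gcongr; exact e4 _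
    _ ≤ g ^ p * (1 + s * (Real.exp (s * (p * L * R)) * a ^ p * lam ^ (-p) / g ^ p) *
        Real.exp (s * (L / lam) ^ p)) := by
        rw [← e3]; gcongr
    _ = _ := by
        have : g ^ p ≠ 0 := by positivity
        rw [mul_add s, Real.exp_add]
        field_simp

theorem exists_linear_le_rpow {q lam L : ℝ} (hq : 1 < q) (hlam : 0 < lam) :
    ∃ R : ℝ, 0 ≤ R ∧ ∀ r, R ≤ r → L * r ≤ (lam * r) ^ q / q := by
  have h : Filter.Tendsto (fun r : ℝ => r ^ (q - 1)) Filter.atTop Filter.atTop :=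
    tendsto_rpow_atTop (by linarith)
  obtain ⟨R, hR⟩ := Filter.eventually_atTop.1 (h.eventually_ge_atTop (L * q / lam ^ q))
  refine ⟨max R 1, by positivity, fun r hr => ?_⟩
  have hr1 : 0 < r := lt_of_lt_of_le one_pos ((le_max_right _ _).trans hr)
  have := hR r ((le_max_left _ _).trans hr)
  have hl : 0 < lam ^ q := by positivity
  rw [div_le_iff₀ hl] at this
  rw [Real.mul_rpow hlam.le hr1.le, le_div_iff₀ (by linarith)]
  calc L * r * q = (L * q) * r := by ring
    _ ≤ r ^ (q - 1) * lam ^ q * r := by gcongr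
    _ = lam ^ q * r ^ q := by rw [Real.rpow_sub_one hr1.ne']; field_simp

theorem lintegral_comp_inv_smul {n : ℕ} {c : ℝ} (hc : 0 < c)
    {F : EuclideanSpace ℝ (Fin n) → ℝ≥0∞} (hF : Measurable F) :
    ∫⁻ x, F (c⁻¹ • x) = ENNReal.ofReal (c ^ n) * ∫⁻ x, F x := by
  rw [← lintegral_map hF (measurable_const_smul _), Measure.map_addHaar_smul _ (by positivity),
    lintegral_smul_measure, smul_eq_mul, finrank_euclideanSpace_fin, inv_pow, inv_inv,
    abs_of_pos (by positivity)]

theorem lintegral_rpow_interpolation {α : Type*} [MeasurableSpace α] {μ : Measure α}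
    {p q t : ℝ} (hpq : p.HolderConjugate q) (ht0 : 0 ≤ t) (ht1 : t * q ≤ 1) {H : α → ℝ}
    (hHm : Measurable H) (hH : ∀ x, 0 < H x) :
    ∫⁻ x, ENNReal.ofReal (H x ^ (p * (1 - t))) ∂μ ≤
      (∫⁻ x, ENNReal.ofReal (H x) ∂μ) ^ (t * q) *
        (∫⁻ x, ENNReal.ofReal (H x ^ p) ∂μ) ^ (1 - t * q) := by
  have hq := hpq.symm.pos
  have e : ∀ x, ENNReal.ofReal (H x ^ (p * (1 - t))) =
      ENNReal.ofReal (H x) ^ (t * q) * ENNReal.ofReal (H x ^ p) ^ (1 - t * q) := by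
    intro x
    have hx := hH x
    rw [ENNReal.ofReal_rpow_of_pos hx, ENNReal.ofReal_rpow_of_pos (by positivity),
      ← ENNReal.ofReal_mul (by positivity), ← Real.rpow_mul hx.le, ← Real.rpow_add hx]
    congr 2
    linear_combination t * hpq.mul_eq_add
  simp_rw [e]
  exact ENNReal.lintegral_mul_norm_pow_le hHm.ennreal_ofReal.aemeasurable
    (hHm.pow_const p).ennreal_ofReal.aemeasurable (by positivity) (by linarith) (by ring)

theorem lintegral_hopfLaxBound_estimate {n : ℕ} {p q lam L R t : ℝ} (hpq : p.HolderConjugate q)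
    (hlam : 0 < lam) (hL : 0 ≤ L) {G A : EuclideanSpace ℝ (Fin n) → ℝ}
    (hGm : Measurable G) (hAm : Measurable A) (hG : ∀ x, 0 < G x) (hA : ∀ x, 0 ≤ A x)
    (h1 : ∀ x d, G (x + d) ≤ Real.exp (L * ‖d‖) * G x)
    (h2 : ∀ x d, G (x + d) ≤ G x + ‖d‖ * Real.exp (L * ‖d‖) * A x)
    (hR : ∀ r, R ≤ r → L * r ≤ (lam * r) ^ q / q) (ht0 : 0 < t) (ht1 : t * q ≤ 1) :
    (∫⁻ x, ENNReal.ofReal (G x ^ p)) ^ (1 - t) *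
      (∫⁻ y : EuclideanSpace ℝ (Fin n), ENNReal.ofReal (Real.exp (-((p - 1) * (lam * ‖y‖) ^ q)))) ^ t
      ≤ ENNReal.ofReal ((1 - t) ^ n) *
        ((ENNReal.ofReal (Real.exp (t / (1 - t) * ((L / lam) ^ p / p))) *
          ∫⁻ x, ENNReal.ofReal (G x)) ^ (t * q) *
        ((∫⁻ x, ENNReal.ofReal (G x ^ p)) + ENNReal.ofReal (t / (1 - t) * lam ^ (-p) *
          Real.exp (t / (1 - t) * ((L / lam) ^ p + p * L * R))) *
          ∫⁻ x, ENNReal.ofReal (A x ^ p)) ^ (1 - t * q)) := by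
  have hp := hpq.pos
  have hq := hpq.symm.pos
  have hq1 := hpq.symm.lt
  have ht1' : t < 1 := by nlinarith
  have ht' : 0 < 1 - t := by linarith
  set s := t / (1 - t) with hs
  have hs0 : 0 ≤ s := by positivity
  set H : EuclideanSpace ℝ (Fin n) → ℝ := fun w => hopfLaxBound p lam L R s (G w) (A w) with hH
  have hHm : Measurable H := by
    unfold H hopfLaxBound
    fun_prop
  have hHpos : ∀ w, 0 < H w := fun w => hopfLaxBound_pos (hG w)
  have hPm : Measurable fun w => ENNReal.ofReal (H w ^ (p * (1 - t))) :=
    (hHm.pow_const _).ennreal_ofReal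
  have key := prekopa_leindler ht0 ht1' (f := fun x => ENNReal.ofReal (G x ^ p))
    (k := fun y => ENNReal.ofReal (Real.exp (-((p - 1) * (lam * ‖y‖) ^ q))))
    (h := fun z => ENNReal.ofReal (H ((1 - t)⁻¹ • z) ^ (p * (1 - t))))
    (hGm.pow_const _).ennreal_ofReal (by fun_prop) (hPm.comp (measurable_const_smul _)) (by
      intro x y
      have hGx := hG x
      set w := (1 - t)⁻¹ • ((1 - t) • x + t • y) with hw
      have hwx : x = w + -(s • y) := by
        rw [hw, smul_add, smul_smul, smul_smul, inv_mul_cancel₀ ht'.ne', hs, div_eq_inv_mul]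
        simp
      have hd : ‖-(s • y)‖ = s * ‖y‖ := by rw [norm_neg, norm_smul, Real.norm_of_nonneg hs0]
      have b := mul_exp_le_hopfLaxBound (u := G x) (r := ‖y‖) hpq hlam hL hs0 (hG w) (hA w)
        (norm_nonneg y) hR (by rw [← hd]; conv_lhs => rw [hwx]
                               exact h1 _ _) (by
          rw [← hd]; conv_lhs => rw [hwx]
          exact h2 _ _)
      rw [ENNReal.ofReal_rpow_of_pos (by positivity), ENNReal.ofReal_rpow_of_pos (by positivity),
        ← ENNReal.ofReal_mul (by positivity)]
      refine ENNReal.ofReal_le_ofReal ?_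
      calc _ = (G x * Real.exp (-(s * ((lam * ‖y‖) ^ q / q)))) ^ (p * (1 - t)) := by
            rw [Real.mul_rpow hGx.le (Real.exp_pos _).le, ← Real.rpow_mul hGx.le, ← Real.exp_mul,
              ← Real.exp_mul]
            congr 2
            have : p - 1 = p / q := by
              rw [eq_div_iff hq.ne']
              linarith [hpq.mul_eq_add]
            rw [this, hs]
            field_simp
        _ ≤ _ := by
            gcongr)
  refine key.trans ?_
  rw [lintegral_comp_inv_smul ht' hPm]
  gcongr
  refine (lintegral_rpow_interpolation hpq ht0.le ht1 hHm hHpos).trans ?_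
  gcongr
  · rw [← lintegral_const_mul _ hGm.ennreal_ofReal]
    refine lintegral_mono fun x => ?_
    rw [← ENNReal.ofReal_mul (Real.exp_pos _).le]
    exact ENNReal.ofReal_le_ofReal (hopfLaxBound_le hs0 (hG x).le)
  · rw [← lintegral_const_mul _ (hAm.pow_const p).ennreal_ofReal,
      ← lintegral_add_left (hGm.pow_const p).ennreal_ofReal]
    refine lintegral_mono fun x => ?_
    have hx := hG x
    have hx' := hA x
    rw [← ENNReal.ofReal_mul (by positivity), ← ENNReal.ofReal_add (by positivity) (by positivity)]
    exact ENNReal.ofReal_le_ofReal (hopfLaxBound_rpow_le hp hlam hL hs0 hx hx')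

theorem log_inequality_of_forall_small {n : ℕ} {q X N Z D κ κ' c : ℝ} (hq : 0 < q) (hX : 0 < X)
    (hN : 0 < N) (hZ : 0 < Z) (hD : 0 ≤ D) (hc : 0 ≤ c)
    (h : ∀ t, 0 < t → t < 1 → t * q ≤ 1 → X ^ (1 - t) * Z ^ t ≤ (1 - t) ^ n *
      ((Real.exp (t / (1 - t) * κ) * N) ^ (t * q) *
        (X + t / (1 - t) * c * Real.exp (t / (1 - t) * κ') * D) ^ (1 - t * q))) :
    (q - 1) * Real.log X + Real.log Z + n ≤ q * Real.log N + c * D / X := by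
  set φ : ℝ → ℝ := fun t => n * Real.log (1 - t) + t * q * (t / (1 - t) * κ + Real.log N) +
    (1 - t * q) * Real.log (X + t / (1 - t) * c * Real.exp (t / (1 - t) * κ') * D) -
    (1 - t) * Real.log X - t * Real.log Z with hφ
  have hs : HasDerivAt (fun t : ℝ => t / (1 - t)) 1 0 := by
    have := (hasDerivAt_id (0 : ℝ)).div ((hasDerivAt_id (0 : ℝ)).const_sub 1) (by simp)
    exact this.congr_deriv (by simp)
  have hY : HasDerivAt (fun t : ℝ => X + t / (1 - t) * c * Real.exp (t / (1 - t) * κ') * D)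
      (c * D) 0 := by
    have := (((hs.mul_const c).mul (hs.mul_const κ').exp).mul_const D).const_add X
    simpa using this
  have hderiv : HasDerivAt φ (-n + q * Real.log N + (-q * Real.log X + c * D / X) + Real.log X -
      Real.log Z) 0 := by
    have hid := hasDerivAt_id (0 : ℝ)
    have d1 := ((hid.const_sub 1).log (by simp)).const_mul (n : ℝ)
    have d2 := (hid.mul_const q).mul ((hs.mul_const κ).add_const (Real.log N))
    have d3 := ((hid.mul_const q).const_sub 1).mul (hY.log (by simp [hX.ne']))
    have d4 := (hid.const_sub 1).mul_const (Real.log X)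
    have d5 := hid.mul_const (Real.log Z)
    convert! (((d1.add d2).add d3).sub d4).sub d5 using 1
    simp
  have hφ0 : φ 0 = 0 := by simp [hφ]
  have hpos : ∀ᶠ t in nhdsWithin (0 : ℝ) (Set.Ioi 0), 0 ≤ t⁻¹ • (φ (0 + t) - φ 0) := by
    have hmem : Set.Ioo (0 : ℝ) (min 1 q⁻¹) ∈ nhdsWithin (0 : ℝ) (Set.Ioi 0) :=
      Ioo_mem_nhdsGT (by positivity)
    filter_upwards [hmem] with t ht
    have ht0 := ht.1
    have ht1 : t < 1 := ht.2.trans_le (min_le_left _ _)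
    have ht' : 0 < 1 - t := by linarith
    have htq : t * q ≤ 1 := by
      have := ht.2.trans_le (min_le_right _ _)
      rw [← one_div, lt_div_iff₀ hq] at this
      exact this.le
    rw [hφ0, sub_zero, zero_add, smul_eq_mul]
    have hYpos : 0 < X + t / (1 - t) * c * Real.exp (t / (1 - t) * κ') * D := by positivity
    have hlog := Real.log_le_log (by positivity) (h t ht0 ht1 htq)
    rw [Real.log_mul (by positivity) (by positivity), Real.log_mul (by positivity) (by positivity),
      Real.log_mul (by positivity) (by positivity), Real.log_rpow hX, Real.log_rpow hZ,
      Real.log_rpow (by positivity), Real.log_rpow hYpos, Real.log_pow,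
      Real.log_mul (by positivity) hN.ne', Real.log_exp] at hlog
    refine mul_nonneg (by positivity) ?_
    simp only [hφ]
    linarith
  have := ge_of_tendsto hderiv.tendsto_slope_zero_right hpos
  linarith

theorem integral_exp_neg_norm_rpow {n : ℕ} (hn : 1 ≤ n) {q : ℝ} (hq : 0 < q) :
    ∫ x : EuclideanSpace ℝ (Fin n), Real.exp (-‖x‖ ^ q) =
      √Real.pi ^ n / Real.Gamma ((n : ℝ) / 2 + 1) * Real.Gamma (n / q + 1) := by
  have : Nonempty (Fin n) := ⟨⟨0, hn⟩⟩
  have hΓ : 0 < Real.Gamma (n / q + 1) := Real.Gamma_pos_of_pos (by positivity)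
  have hΓ2 : 0 < Real.Gamma ((n : ℝ) / 2 + 1) := Real.Gamma_pos_of_pos (by positivity)
  have hball := measure_lt_one_eq_integral_div_gamma
    (volume : Measure (EuclideanSpace ℝ (Fin n))) (g := fun x => ‖x‖) norm_zero norm_neg
    norm_add_le (fun h => norm_eq_zero.1 h) (fun r x => (norm_smul r x).le) hq
  have hset : {x : EuclideanSpace ℝ (Fin n) | ‖x‖ < 1} = Metric.ball 0 1 := by
    ext x; simp
  rw [hset, EuclideanSpace.volume_ball, finrank_euclideanSpace_fin, Fintype.card_fin] at hball
  simp only [ENNReal.ofReal_one, one_pow, one_mul] at hball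
  have hpos : 0 < √Real.pi ^ n / Real.Gamma ((n : ℝ) / 2 + 1) := by positivity
  have hInn : 0 ≤ ∫ x : EuclideanSpace ℝ (Fin n), Real.exp (-‖x‖ ^ q) :=
    integral_nonneg fun x => (Real.exp_pos _).le
  rw [ENNReal.ofReal_eq_ofReal_iff hpos.le (by positivity)] at hball
  rw [hball]
  field_simp

theorem integrable_exp_neg_norm_rpow {n : ℕ} (hn : 1 ≤ n) {q : ℝ} (hq : 0 < q) :
    Integrable fun x : EuclideanSpace ℝ (Fin n) => Real.exp (-‖x‖ ^ q) := by
  have hI := integral_exp_neg_norm_rpow hn hq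
  have hΓ : 0 < Real.Gamma (n / q + 1) := Real.Gamma_pos_of_pos (by positivity)
  have hΓ2 : 0 < Real.Gamma ((n : ℝ) / 2 + 1) := Real.Gamma_pos_of_pos (by positivity)
  by_contra hni
  rw [integral_undef hni] at hI
  exact absurd hI (by positivity)

theorem lintegral_exp_neg_norm_rpow {n : ℕ} (hn : 1 ≤ n) {p q lam : ℝ} (hpq : p.HolderConjugate q)
    (hlam : 0 < lam) :
    ∫⁻ y : EuclideanSpace ℝ (Fin n), ENNReal.ofReal (Real.exp (-((p - 1) * (lam * ‖y‖) ^ q))) =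
      ENNReal.ofReal ((p - 1) ^ (-((n : ℝ) / q)) * lam ^ (-(n : ℝ)) * Real.pi ^ ((n : ℝ) / 2) *
        Real.Gamma (n / q + 1) / Real.Gamma (n / 2 + 1)) := by
  have hq := hpq.symm.pos
  have hp1 : 0 < p - 1 := by linarith [hpq.lt]
  set c := (p - 1) ^ (-q⁻¹) * lam⁻¹ with hc
  have hc0 : 0 < c := by positivity
  have hfun : ∀ y : EuclideanSpace ℝ (Fin n), Real.exp (-((p - 1) * (lam * ‖y‖) ^ q)) =
      Real.exp (-‖c⁻¹ • y‖ ^ q) := by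
    intro y
    rw [norm_smul, Real.norm_of_nonneg (by positivity), hc, mul_inv, inv_inv, mul_assoc,
      Real.rpow_neg hp1.le, inv_inv, Real.mul_rpow (x := (p - 1) ^ q⁻¹) (by positivity)
        (by positivity), ← Real.rpow_mul hp1.le, inv_mul_cancel₀ hq.ne', Real.rpow_one]
  simp_rw [hfun]
  rw [lintegral_comp_inv_smul hc0 (F := fun x => ENNReal.ofReal (Real.exp (-‖x‖ ^ q)))
    (by fun_prop), ← ofReal_integral_eq_lintegral_ofReal (integrable_exp_neg_norm_rpow hn hq)
    (ae_of_all _ fun x => (Real.exp_pos _).le), integral_exp_neg_norm_rpow hn hq,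
    ← ENNReal.ofReal_mul (by positivity)]
  congr 1
  rw [hc, mul_pow, ← Real.rpow_natCast, ← Real.rpow_mul hp1.le, Real.sqrt_eq_rpow,
    ← Real.rpow_natCast (Real.pi ^ _), ← Real.rpow_mul Real.pi_pos.le, inv_pow,
    Real.rpow_neg hlam.le, Real.rpow_natCast]
  ring_nf

theorem nash_of_log_inequality {n : ℕ} (hn : 1 ≤ n) {p q X N D : ℝ} (hpq : p.HolderConjugate q)
    (hX : 0 < X) (hN : 0 < N) (hD : 0 < D)
    (h : ∀ lam, 0 < lam → (q - 1) * Real.log X +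
      Real.log ((p - 1) ^ (-((n : ℝ) / q)) * lam ^ (-(n : ℝ)) * Real.pi ^ ((n : ℝ) / 2) *
        Real.Gamma (n / q + 1) / Real.Gamma (n / 2 + 1)) + n
        ≤ q * Real.log N + lam ^ (-p) * D / X) :
    X ^ (1 + q / (n : ℝ)) ≤ p ^ p * (gammaConst n p q)⁻¹ * N ^ (p * q / (n : ℝ)) * D := by
  have hp := hpq.pos
  have hq := hpq.symm.pos
  have hp1 : 0 < p - 1 := by linarith [hpq.lt]
  have hn0 : (0 : ℝ) < n := by exact_mod_cast hn
  have hΓ : 0 < Real.Gamma (n / q + 1) := Real.Gamma_pos_of_pos (by positivity)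
  have hΓ2 : 0 < Real.Gamma ((n : ℝ) / 2 + 1) := Real.Gamma_pos_of_pos (by positivity)
  have hγ : 0 < gammaConst n p q := by unfold gammaConst; positivity
  have hqp : q = p / (p - 1) := hpq.conjugate_eq
  set lam := (n * X / (p * D)) ^ (-p⁻¹) with hlam
  have hb : 0 < n * X / (p * D) := by positivity
  have hlam0 : 0 < lam := by positivity
  have hlamp : lam ^ (-p) * D / X = n / p := by
    rw [hlam, ← Real.rpow_mul hb.le, neg_mul_neg, inv_mul_cancel₀ hp.ne', Real.rpow_one]
    field_simp
  have hloglam : Real.log lam = -p⁻¹ * (Real.log n + Real.log X - Real.log p - Real.log D) := by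
    rw [hlam, Real.log_rpow hb, Real.log_div (by positivity) (by positivity),
      Real.log_mul hn0.ne' hX.ne', Real.log_mul hp.ne' hD.ne']
    ring
  have hmain := h lam hlam0
  rw [hlamp, Real.log_div (by positivity) hΓ2.ne', Real.log_mul (by positivity) hΓ.ne',
    Real.log_mul (by positivity) (by positivity), Real.log_mul (by positivity) (by positivity),
    Real.log_rpow hp1, Real.log_rpow hlam0, Real.log_rpow Real.pi_pos, hloglam] at hmain
  have hlogγ : Real.log (gammaConst n p q) = Real.log n + (p - 1) * (Real.log p - Real.log (p - 1)
      + 1) + p / 2 * Real.log Real.pi - p / n * (Real.log (Real.Gamma ((n : ℝ) / 2 + 1)) -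
      Real.log (Real.Gamma (n / q + 1))) := by
    unfold gammaConst
    rw [Real.log_mul (by positivity) (by positivity), Real.log_mul (by positivity) (by positivity),
      Real.log_mul (by positivity) (by positivity), Real.log_rpow (by positivity),
      Real.log_rpow Real.pi_pos, Real.log_rpow (by positivity), Real.log_div hΓ2.ne' hΓ.ne',
      Real.log_mul hq.ne' (Real.exp_pos 1).ne', Real.log_exp, hqp, Real.log_div hp.ne' hp1.ne']
    ring
  rw [← Real.log_le_log_iff (by positivity) (by positivity), Real.log_mul (by positivity) hD.ne',
    Real.log_mul (by positivity) (by positivity), Real.log_mul (by positivity) (by positivity),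
    Real.log_rpow hX, Real.log_rpow hp, Real.log_rpow hN, Real.log_inv, hlogγ]
  have hmul := mul_le_mul_of_nonneg_left hmain (show 0 ≤ p / n by positivity)
  generalize Real.log (Real.Gamma ((n : ℝ) / 2 + 1)) = l1 at *
  generalize Real.log (Real.Gamma (n / q + 1)) = l2 at *
  rw [← sub_nonneg] at hmul ⊢
  refine hmul.trans_eq ?_
  rw [hqp]
  field_simp
  ring

theorem nash_of_log_lipschitz {n : ℕ} (hn : 1 ≤ n) {p q L X N D : ℝ} (hpq : p.HolderConjugate q)
    (hL : 0 ≤ L) {G A : EuclideanSpace ℝ (Fin n) → ℝ}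
    (hGm : Measurable G) (hAm : Measurable A) (hG : ∀ x, 0 < G x) (hA : ∀ x, 0 ≤ A x)
    (h1 : ∀ x d, G (x + d) ≤ Real.exp (L * ‖d‖) * G x)
    (h2 : ∀ x d, G (x + d) ≤ G x + ‖d‖ * Real.exp (L * ‖d‖) * A x)
    (hX : 0 < X) (hN : 0 < N) (hD : 0 < D)
    (hGX : ∫⁻ x, ENNReal.ofReal (G x ^ p) = ENNReal.ofReal X)
    (hGN : ∫⁻ x, ENNReal.ofReal (G x) ≤ ENNReal.ofReal N)
    (hAD : ∫⁻ x, ENNReal.ofReal (A x ^ p) ≤ ENNReal.ofReal D) :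
    X ^ (1 + q / (n : ℝ)) ≤ p ^ p * (gammaConst n p q)⁻¹ * N ^ (p * q / (n : ℝ)) * D := by
  have hp := hpq.pos
  have hq := hpq.symm.pos
  have hp1 : 0 < p - 1 := by linarith [hpq.lt]
  have hΓ : 0 < Real.Gamma (n / q + 1) := Real.Gamma_pos_of_pos (by positivity)
  have hΓ2 : 0 < Real.Gamma ((n : ℝ) / 2 + 1) := Real.Gamma_pos_of_pos (by positivity)
  refine nash_of_log_inequality hn hpq hX hN hD fun lam hlam => ?_
  obtain ⟨R, hR0, hR⟩ := exists_linear_le_rpow (L := L) hpq.symm.lt hlam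
  refine log_inequality_of_forall_small (κ := (L / lam) ^ p / p)
    (κ' := (L / lam) ^ p + p * L * R) hq hX hN (by positivity) hD.le (by positivity) ?_
  intro t ht0 ht1 htq
  have ht' : 0 < 1 - t := by linarith
  have key := lintegral_hopfLaxBound_estimate hpq hlam hL hGm hAm hG hA h1 h2 hR ht0 htq
  rw [hGX, lintegral_exp_neg_norm_rpow hn hpq hlam] at key
  have key2 := key.trans (mul_le_mul_right (mul_le_mul'
    (ENNReal.rpow_le_rpow (mul_le_mul_right hGN _) (by positivity))
    (ENNReal.rpow_le_rpow (add_le_add_right (mul_le_mul_right hAD _) _) (by linarith))) _)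
  rw [← ENNReal.ofReal_mul (by positivity), ← ENNReal.ofReal_mul (by positivity),
    ← ENNReal.ofReal_add (by positivity) (by positivity),
    ENNReal.ofReal_rpow_of_pos (by positivity), ENNReal.ofReal_rpow_of_pos (by positivity),
    ENNReal.ofReal_rpow_of_pos (by positivity), ENNReal.ofReal_rpow_of_pos (by positivity),
    ← ENNReal.ofReal_mul (by positivity), ← ENNReal.ofReal_mul (by positivity),
    ← ENNReal.ofReal_mul (by positivity), ENNReal.ofReal_le_ofReal_iff (by positivity)] at key2
  exact key2

/-- Convolution of `u` with the kernel `K`, with values in `ℝ≥0∞`. -/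
noncomputable def mollify {n : ℕ} (K u : EuclideanSpace ℝ (Fin n) → ℝ≥0∞)
    (x : EuclideanSpace ℝ (Fin n)) : ℝ≥0∞ :=
  ∫⁻ z, K z * u (x - z)

section mollify

variable {n : ℕ} {K u v : EuclideanSpace ℝ (Fin n) → ℝ≥0∞}

theorem mollify_eq (x : EuclideanSpace ℝ (Fin n)) : mollify K u x = ∫⁻ y, K (x - y) * u y := by
  rw [mollify, ← lintegral_sub_left_eq_self _ x]
  simp

theorem measurable_mollify (hK : Measurable K) (hu : Measurable u) : Measurable (mollify K u) := by
  unfold mollify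
  exact Measurable.lintegral_prod_right' (f := fun w : EuclideanSpace ℝ (Fin n) ×
    EuclideanSpace ℝ (Fin n) => K w.2 * u (w.1 - w.2)) (by fun_prop)

theorem lintegral_mollify (hK : Measurable K) (hu : Measurable u) (hK1 : ∫⁻ z, K z = 1) :
    ∫⁻ x, mollify K u x = ∫⁻ x, u x := by
  unfold mollify
  rw [lintegral_lintegral_swap (by fun_prop)]
  have : ∀ z, ∫⁻ x, K z * u (x - z) = K z * ∫⁻ x, u x := by
    intro z
    rw [lintegral_const_mul _ (by fun_prop), lintegral_sub_right_eq_self]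
  simp_rw [this]
  rw [lintegral_mul_const _ hK, hK1, one_mul]

theorem mollify_rpow_le {p q : ℝ} (hpq : p.HolderConjugate q) (hK : Measurable K)
    (hu : Measurable u) (hK1 : ∫⁻ z, K z = 1) (x : EuclideanSpace ℝ (Fin n)) :
    mollify K u x ^ p ≤ mollify K (fun y => u y ^ p) x := by
  have hp := hpq.pos
  have hq := hpq.symm.pos
  have e : ∀ z, K z * u (x - z) = K z ^ q⁻¹ * (K z * u (x - z) ^ p) ^ p⁻¹ := by
    intro z
    rw [ENNReal.mul_rpow_of_nonneg _ _ (by positivity), ← mul_assoc,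
      ← ENNReal.rpow_add_of_nonneg _ _ (by positivity) (by positivity),
      hpq.symm.inv_add_inv_eq_one, ENNReal.rpow_one, ENNReal.rpow_rpow_inv hp.ne']
  have := ENNReal.lintegral_mul_norm_pow_le (μ := volume) (f := K)
    (g := fun z => K z * u (x - z) ^ p) hK.aemeasurable (by fun_prop)
    (p := q⁻¹) (q := p⁻¹) (by positivity) (by positivity) hpq.symm.inv_add_inv_eq_one
  simp_rw [← e] at this
  rw [hK1, ENNReal.one_rpow, one_mul] at this
  exact (ENNReal.le_rpow_inv_iff hp).1 this

theorem lintegral_mollify_rpow_le {p q : ℝ} (hpq : p.HolderConjugate q) (hK : Measurable K)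
    (hu : Measurable u) (hK1 : ∫⁻ z, K z = 1) :
    ∫⁻ x, mollify K u x ^ p ≤ ∫⁻ x, u x ^ p :=
  (lintegral_mono fun x => mollify_rpow_le hpq hK hu hK1 x).trans_eq
    (lintegral_mollify hK (hu.pow_const p) hK1)

theorem mollify_lt_top {B : ℝ≥0∞} (hB : B ≠ ∞) (hKB : ∀ z, K z ≤ B) (hu : ∫⁻ x, u x ≠ ∞)
    (x : EuclideanSpace ℝ (Fin n)) : mollify K u x < ∞ := by
  rw [mollify_eq]
  calc ∫⁻ y, K (x - y) * u y ≤ ∫⁻ y, B * u y := by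
        gcongr with y; exact hKB _
    _ = B * ∫⁻ y, u y := lintegral_const_mul' _ _ hB
    _ < ∞ := ENNReal.mul_lt_top hB.lt_top hu.lt_top

theorem mollify_add_le {L : ℝ}
    (hKL : ∀ x d, K (x + d) ≤ ENNReal.ofReal (Real.exp (L * ‖d‖)) * K x)
    (x d : EuclideanSpace ℝ (Fin n)) :
    mollify K u (x + d) ≤ ENNReal.ofReal (Real.exp (L * ‖d‖)) * mollify K u x := by
  rw [mollify_eq, mollify_eq, ← lintegral_const_mul' _ _ ENNReal.ofReal_ne_top]
  refine lintegral_mono fun y => ?_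
  rw [← mul_assoc, add_sub_right_comm]
  gcongr
  exact hKL _ _

theorem mollify_add_le_add {L : ℝ} (hL : 0 ≤ L) (hK : Measurable K)
    (hKL : ∀ x d, K (x + d) ≤ ENNReal.ofReal (Real.exp (L * ‖d‖)) * K x)
    (hu : Measurable u) (hv : Measurable v)
    (huv : ∀ x d, u (x + d) ≤ u x + ‖d‖ₑ * ∫⁻ τ in Set.Ioc (0 : ℝ) 1, v (x + τ • d))
    (x d : EuclideanSpace ℝ (Fin n)) :
    mollify K u (x + d) ≤
      mollify K u x + ‖d‖ₑ * ENNReal.ofReal (Real.exp (L * ‖d‖)) * mollify K v x := by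
  have hvm : Measurable fun w : EuclideanSpace ℝ (Fin n) × ℝ => v (x - w.1 + w.2 • d) := by
    fun_prop
  have hvm2 : Measurable fun z => ∫⁻ τ in Set.Ioc (0 : ℝ) 1, v (x - z + τ • d) :=
    hvm.lintegral_prod_right'
  calc mollify K u (x + d)
      ≤ ∫⁻ z, (K z * u (x - z) +
          ‖d‖ₑ * ∫⁻ τ in Set.Ioc (0 : ℝ) 1, K z * v (x - z + τ • d)) := by
        refine lintegral_mono fun z => ?_
        rw [lintegral_const_mul _ (by fun_prop), mul_left_comm, ← mul_add, add_sub_right_comm]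
        gcongr
        exact huv _ _
    _ = mollify K u x + ‖d‖ₑ * ∫⁻ τ in Set.Ioc (0 : ℝ) 1, mollify K v (x + τ • d) := by
        rw [lintegral_add_left (by fun_prop), lintegral_const_mul' _ _ enorm_ne_top,
          lintegral_lintegral_swap (by fun_prop)]
        simp only [mollify, add_sub_right_comm]
    _ ≤ mollify K u x + ‖d‖ₑ * ∫⁻ _ in Set.Ioc (0 : ℝ) 1,
          ENNReal.ofReal (Real.exp (L * ‖d‖)) * mollify K v x := by
        gcongr mollify K u x + ‖d‖ₑ * ?_
        refine setLIntegral_mono measurable_const fun τ hτ => (mollify_add_le hKL _ _).trans ?_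
        gcongr
        rw [norm_smul, Real.norm_of_nonneg hτ.1.le]
        exact mul_le_of_le_one_left (norm_nonneg d) hτ.2
    _ = _ := by simp [mul_assoc]

end mollify

theorem ofReal_add_le_lintegral_fderiv {E : Type*} [NormedAddCommGroup E] [NormedSpace ℝ E]
    {g : E → ℝ} (hg : ContDiff ℝ 1 g) (x d : E) :
    ENNReal.ofReal (g (x + d)) ≤
      ENNReal.ofReal (g x) + ‖d‖ₑ * ∫⁻ τ in Set.Ioc (0 : ℝ) 1, ‖fderiv ℝ g (x + τ • d)‖ₑ := by
  have hcont : Continuous (fderiv ℝ g) := hg.continuous_fderiv one_ne_zero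
  have hderiv : ∀ τ : ℝ, HasDerivAt (fun τ : ℝ => g (x + τ • d)) (fderiv ℝ g (x + τ • d) d) τ := by
    intro τ
    have h1 : HasDerivAt (fun τ : ℝ => x + τ • d) d τ := by
      simpa using ((hasDerivAt_id τ).smul_const d).const_add x
    exact ((hg.differentiable one_ne_zero) _).hasFDerivAt.comp_hasDerivAt τ h1
  have hc : Continuous fun τ : ℝ => fderiv ℝ g (x + τ • d) d := by fun_prop
  have hftc := intervalIntegral.integral_eq_sub_of_hasDerivAt (a := 0) (b := 1)
    (fun τ _ => hderiv τ) (hc.intervalIntegrable _ _)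
  rw [intervalIntegral.integral_of_le zero_le_one] at hftc
  simp only [one_smul, zero_smul, add_zero] at hftc
  calc ENNReal.ofReal (g (x + d))
      = ENNReal.ofReal (g x + ∫ τ in Set.Ioc (0 : ℝ) 1, fderiv ℝ g (x + τ • d) d) := by
        rw [hftc]; ring_nf
    _ ≤ ENNReal.ofReal (g x) + ENNReal.ofReal (∫ τ in Set.Ioc (0 : ℝ) 1, fderiv ℝ g (x + τ • d) d) :=
        ENNReal.ofReal_add_le
    _ ≤ ENNReal.ofReal (g x) + ‖∫ τ in Set.Ioc (0 : ℝ) 1, fderiv ℝ g (x + τ • d) d‖ₑ := by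
        gcongr
        exact Real.ofReal_le_enorm _
    _ ≤ ENNReal.ofReal (g x) + ∫⁻ τ in Set.Ioc (0 : ℝ) 1, ‖d‖ₑ * ‖fderiv ℝ g (x + τ • d)‖ₑ := by
        gcongr
        refine (enorm_integral_le_lintegral_enorm _).trans (lintegral_mono fun τ => ?_)
        rw [mul_comm]
        exact ContinuousLinearMap.le_opENorm _ _
    _ = _ := by rw [lintegral_const_mul' _ _ enorm_ne_top]

/-- The normalized kernel proportional to `exp (-L ‖x‖)`. -/
noncomputable def expKernel (n : ℕ) (L : ℝ) (x : EuclideanSpace ℝ (Fin n)) : ℝ≥0∞ :=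
  ENNReal.ofReal (L ^ n * (∫ y : EuclideanSpace ℝ (Fin n), Real.exp (-‖y‖))⁻¹ *
    Real.exp (-(L * ‖x‖)))

section expKernel

variable {n : ℕ} {L : ℝ}

theorem measurable_expKernel : Measurable (expKernel n L) := by
  unfold expKernel
  fun_prop

theorem integral_exp_neg_norm_pos (hn : 1 ≤ n) :
    0 < ∫ y : EuclideanSpace ℝ (Fin n), Real.exp (-‖y‖) := by
  have h := integral_exp_neg_norm_rpow hn one_pos
  simp only [Real.rpow_one, div_one] at h
  rw [h]
  have hΓ : 0 < Real.Gamma ((n : ℝ) + 1) := Real.Gamma_pos_of_pos (by positivity)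
  have hΓ2 : 0 < Real.Gamma ((n : ℝ) / 2 + 1) := Real.Gamma_pos_of_pos (by positivity)
  positivity

theorem expKernel_eq (hL : 0 < L) (x : EuclideanSpace ℝ (Fin n)) :
    expKernel n L x = ENNReal.ofReal (L ^ n) * expKernel n 1 (L • x) := by
  rw [expKernel, expKernel, ← ENNReal.ofReal_mul (by positivity), norm_smul,
    Real.norm_of_nonneg hL.le]
  ring_nf

/-- Integration against `expKernel n L` amounts to rescaling in `expKernel n 1`. -/
theorem lintegral_expKernel_mul (hL : 0 < L) {u : EuclideanSpace ℝ (Fin n) → ℝ≥0∞}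
    (hu : Measurable u) :
    ∫⁻ z, expKernel n L z * u z = ∫⁻ z, expKernel n 1 z * u (L⁻¹ • z) := by
  have := lintegral_comp_inv_smul (n := n) (c := L⁻¹) (by positivity)
    (F := fun z => expKernel n 1 z * u (L⁻¹ • z))
    (measurable_expKernel.mul (hu.comp (measurable_const_smul _)))
  simp only [inv_inv, smul_smul, inv_mul_cancel₀ hL.ne', one_smul] at this
  simp_rw [expKernel_eq hL, mul_assoc]
  rw [lintegral_const_mul' _ _ ENNReal.ofReal_ne_top, this, ← mul_assoc,
    ← ENNReal.ofReal_mul (by positivity), ← mul_pow, mul_inv_cancel₀ hL.ne']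
  simp

theorem lintegral_expKernel (hn : 1 ≤ n) (hL : 0 < L) : ∫⁻ z, expKernel n L z = 1 := by
  have h1 : ∫⁻ z, expKernel n 1 z = 1 := by
    have hpos := integral_exp_neg_norm_pos hn
    have hint := integrable_exp_neg_norm_rpow hn one_pos
    simp only [Real.rpow_one] at hint
    simp only [expKernel, one_pow, one_mul]
    rw [← ofReal_integral_eq_lintegral_ofReal (hint.const_mul _)
      (ae_of_all _ fun x => by positivity), integral_const_mul, inv_mul_cancel₀ hpos.ne',
      ENNReal.ofReal_one]
  simpa [h1] using lintegral_expKernel_mul (n := n) hL (u := fun _ => 1) measurable_const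

theorem expKernel_add_le (hn : 1 ≤ n) (hL : 0 < L) (x d : EuclideanSpace ℝ (Fin n)) :
    expKernel n L (x + d) ≤ ENNReal.ofReal (Real.exp (L * ‖d‖)) * expKernel n L x := by
  have hpos := integral_exp_neg_norm_pos hn
  rw [expKernel, expKernel, ← ENNReal.ofReal_mul (by positivity), mul_left_comm, ← Real.exp_add]
  refine ENNReal.ofReal_le_ofReal ?_
  gcongr
  have : ‖x‖ ≤ ‖x + d‖ + ‖d‖ := by simpa using norm_sub_le (x + d) d
  nlinarith

theorem expKernel_le (hn : 1 ≤ n) (hL : 0 < L) (x : EuclideanSpace ℝ (Fin n)) :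
    expKernel n L x ≤
      ENNReal.ofReal (L ^ n * (∫ y : EuclideanSpace ℝ (Fin n), Real.exp (-‖y‖))⁻¹) := by
  have hpos := integral_exp_neg_norm_pos hn
  refine ENNReal.ofReal_le_ofReal (mul_le_of_le_one_right (by positivity) ?_)
  rw [Real.exp_le_one_iff, neg_nonpos]
  positivity

theorem expKernel_pos (hn : 1 ≤ n) (hL : 0 < L) (x : EuclideanSpace ℝ (Fin n)) :
    0 < expKernel n L x := by
  have hpos := integral_exp_neg_norm_pos hn
  exact ENNReal.ofReal_pos.2 (by positivity)

theorem le_liminf_mollify_expKernel (hn : 1 ≤ n) {u : EuclideanSpace ℝ (Fin n) → ℝ≥0∞}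
    (hu : Continuous u) (x : EuclideanSpace ℝ (Fin n)) :
    u x ≤ Filter.liminf (fun m : ℕ => mollify (expKernel n (m + 1)) u x) Filter.atTop := by
  have hscale : ∀ m : ℕ, mollify (expKernel n (m + 1)) u x =
      ∫⁻ z, expKernel n 1 z * u (x - ((m : ℝ) + 1)⁻¹ • z) := fun m =>
    lintegral_expKernel_mul (n := n) (L := (m : ℝ) + 1) (by positivity)
      (u := fun z => u (x - z)) (hu.measurable.comp (measurable_const.sub measurable_id))
  have hlim : ∀ z, Filter.Tendsto (fun m : ℕ => expKernel n 1 z * u (x - ((m : ℝ) + 1)⁻¹ • z))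
      Filter.atTop (nhds (expKernel n 1 z * u x)) := by
    intro z
    have h0 : Filter.Tendsto (fun m : ℕ => ((m : ℝ) + 1)⁻¹) Filter.atTop (nhds 0) := by
      simpa using tendsto_one_div_add_atTop_nhds_zero_nat (𝕜 := ℝ)
    have h1 : Filter.Tendsto (fun m : ℕ => x - ((m : ℝ) + 1)⁻¹ • z) Filter.atTop (nhds x) := by
      simpa using (h0.smul_const z).const_sub x
    exact ENNReal.Tendsto.const_mul ((hu.tendsto x).comp h1) (Or.inr ENNReal.ofReal_ne_top)
  simp_rw [hscale]
  calc u x = ∫⁻ z, expKernel n 1 z * u x := by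
        rw [lintegral_mul_const _ measurable_expKernel, lintegral_expKernel hn one_pos, one_mul]
    _ = ∫⁻ z, Filter.liminf (fun m : ℕ => expKernel n 1 z * u (x - ((m : ℝ) + 1)⁻¹ • z))
          Filter.atTop := lintegral_congr fun z => (hlim z).liminf_eq.symm
    _ ≤ _ := lintegral_liminf_le fun m => measurable_expKernel.mul
          (hu.measurable.comp (by fun_prop))

end expKernel

theorem lintegral_pos_of_forall_pos {n : ℕ} {f : EuclideanSpace ℝ (Fin n) → ℝ≥0∞}
    (hfm : Measurable f) (hf : ∀ x, 0 < f x) : 0 < ∫⁻ x, f x := by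
  rw [lintegral_pos_iff_support hfm, Function.support_eq_univ fun x => (hf x).ne']
  exact Measure.measure_univ_pos.2 (NeZero.ne _)

theorem gammaConst_pos {n : ℕ} (hn : 1 ≤ n) {p q : ℝ} (hq : 0 < q) : 0 < gammaConst n p q := by
  have hn0 : (0 : ℝ) < n := by exact_mod_cast hn
  have hΓ : 0 < Real.Gamma (n / q + 1) := Real.Gamma_pos_of_pos (by positivity)
  have hΓ2 : 0 < Real.Gamma ((n : ℝ) / 2 + 1) := Real.Gamma_pos_of_pos (by positivity)
  unfold gammaConst
  positivity

theorem lintegral_mollify_expKernel_rpow_le {n : ℕ} (hn : 1 ≤ n) {p q L N D : ℝ}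
    (hpq : p.HolderConjugate q) (hL : 0 < L) {g : EuclideanSpace ℝ (Fin n) → ℝ}
    (hg : ContDiff ℝ 1 g) (hgpos : ∀ x, 0 < g x) (hN : 0 < N) (hD : 0 < D)
    (hgN : ∫⁻ x, ENNReal.ofReal (g x) = ENNReal.ofReal N)
    (hgp : ∫⁻ x, ENNReal.ofReal (g x) ^ p ≠ ∞)
    (hgD : ∫⁻ x, ‖fderiv ℝ g x‖ₑ ^ p ≤ ENNReal.ofReal D) :
    ∫⁻ x, mollify (expKernel n L) (fun y => ENNReal.ofReal (g y)) x ^ p ≤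
      ENNReal.ofReal ((p ^ p * (gammaConst n p q)⁻¹ * N ^ (p * q / (n : ℝ)) * D) ^
        (1 + q / (n : ℝ))⁻¹) := by
  have hp := hpq.pos
  have hq := hpq.symm.pos
  set K := expKernel n L
  set u : EuclideanSpace ℝ (Fin n) → ℝ≥0∞ := fun y => ENNReal.ofReal (g y)
  set v : EuclideanSpace ℝ (Fin n) → ℝ≥0∞ := fun y => ‖fderiv ℝ g y‖ₑ
  have hK : Measurable K := measurable_expKernel
  have hK1 : ∫⁻ z, K z = 1 := lintegral_expKernel hn hL
  have hum : Measurable u := hg.continuous.measurable.ennreal_ofReal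
  have hvm : Measurable v := (hg.continuous_fderiv one_ne_zero).measurable.enorm
  have hKu := measurable_mollify hK hum
  have hKv := measurable_mollify hK hvm
  have hufin : ∀ x, mollify K u x ≠ ∞ := fun x =>
    (mollify_lt_top ENNReal.ofReal_ne_top (expKernel_le hn hL)
      (by rw [hgN]; exact ENNReal.ofReal_ne_top) x).ne
  have hvfin : ∀ x, mollify K v x ≠ ∞ := fun x => by
    have h1 := mollify_lt_top (u := fun y => v y ^ p) ENNReal.ofReal_ne_top (expKernel_le hn hL)
      (hgD.trans_lt ENNReal.ofReal_lt_top).ne x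
    have h2 := (mollify_rpow_le hpq hK hvm hK1 x).trans_lt h1
    exact (ENNReal.rpow_lt_top_iff_of_pos hp).1 h2 |>.ne
  have hupos : ∀ x, 0 < mollify K u x := fun x =>
    lintegral_pos_of_forall_pos (by fun_prop) fun z =>
      ENNReal.mul_pos (expKernel_pos hn hL z).ne' (ENNReal.ofReal_pos.2 (hgpos _)).ne'
  have hXfin : ∫⁻ x, mollify K u x ^ p ≠ ∞ :=
    ((lintegral_mollify_rpow_le hpq hK hum hK1).trans_lt hgp.lt_top).ne
  have hXpos : 0 < ∫⁻ x, mollify K u x ^ p :=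
    lintegral_pos_of_forall_pos (hKu.pow_const p) fun x => ENNReal.rpow_pos (hupos x) (hufin x)
  have hreal : ∀ w : ℝ≥0∞, w ≠ ∞ → ENNReal.ofReal (w.toReal ^ p) = w ^ p := fun w hw => by
    rw [← ENNReal.ofReal_rpow_of_nonneg ENNReal.toReal_nonneg hp.le, ENNReal.ofReal_toReal hw]
  have key := nash_of_log_lipschitz hn (X := (∫⁻ x, mollify K u x ^ p).toReal) hpq hL.le
    (G := fun x => (mollify K u x).toReal) (A := fun x => (mollify K v x).toReal)
    hKu.ennreal_toReal hKv.ennreal_toReal (fun x => ENNReal.toReal_pos (hupos x).ne' (hufin x))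
    (fun x => ENNReal.toReal_nonneg)
    (fun x d => by
      have := ENNReal.toReal_mono (ENNReal.mul_ne_top ENNReal.ofReal_ne_top (hufin x))
        (mollify_add_le (u := u) (expKernel_add_le hn hL) x d)
      rwa [ENNReal.toReal_mul, ENNReal.toReal_ofReal (Real.exp_pos _).le] at this)
    (fun x d => by
      have hne := ENNReal.mul_ne_top (ENNReal.mul_ne_top (enorm_ne_top (x := d))
        (ENNReal.ofReal_ne_top (r := Real.exp (L * ‖d‖)))) (hvfin x)
      have := ENNReal.toReal_mono (ENNReal.add_ne_top.2 ⟨hufin x, hne⟩)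
        (mollify_add_le_add hL.le hK (expKernel_add_le hn hL) hum hvm
          (ofReal_add_le_lintegral_fderiv hg) x d)
      rwa [ENNReal.toReal_add (hufin x) hne, ENNReal.toReal_mul, ENNReal.toReal_mul,
        ENNReal.toReal_ofReal (Real.exp_pos _).le, toReal_enorm] at this)
    (ENNReal.toReal_pos hXpos.ne' hXfin) hN hD
    (by simp_rw [hreal _ (hufin _)]; rw [ENNReal.ofReal_toReal hXfin])
    (by simp_rw [ENNReal.ofReal_toReal (hufin _)]
        rw [lintegral_mollify hK hum hK1, ← hgN])
    (by simp_rw [hreal _ (hvfin _)]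
        exact (lintegral_mollify_rpow_le hpq hK hvm hK1).trans hgD)
  rw [← ENNReal.ofReal_toReal hXfin]
  refine ENNReal.ofReal_le_ofReal ?_
  have hγ := gammaConst_pos (p := p) hn hq
  exact (Real.le_rpow_inv_iff_of_pos ENNReal.toReal_nonneg (by positivity) (by positivity)).2 key

theorem Lp_Nash_inequality (n : ℕ) (hn : 1 ≤ n) (p q : ℝ) (hp : 1 < p)
    (hq : q = p / (p - 1))
    (g : EuclideanSpace ℝ (Fin n) → ℝ) (hg : ContDiff ℝ 1 g) (hgpos : ∀ x, 0 < g x)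
    (hg1 : Integrable g) (hgp : Integrable (fun x => g x ^ p))
    (hgrad : Integrable (fun x => ‖fderiv ℝ g x‖ ^ p)) :
    (∫ x, g x ^ p) ^ (1 + q / (n : ℝ)) ≤
      p ^ p * (gammaConst n p q)⁻¹ * (∫ x, g x) ^ (p * q / (n : ℝ)) *
        ∫ x, ‖fderiv ℝ g x‖ ^ p := by
  have hpq : p.HolderConjugate q := hq ▸ Real.HolderConjugate.conjExponent hp
  have hp0 := hpq.pos
  have hq0 := hpq.symm.pos
  have hgm := hg.continuous.measurable
  have hgN : ∫⁻ x, ENNReal.ofReal (g x) = ENNReal.ofReal (∫ x, g x) :=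
    (ofReal_integral_eq_lintegral_ofReal hg1 (ae_of_all _ fun x => (hgpos x).le)).symm
  have hgX : ∫⁻ x, ENNReal.ofReal (g x) ^ p = ENNReal.ofReal (∫ x, g x ^ p) := by
    rw [ofReal_integral_eq_lintegral_ofReal hgp
      (ae_of_all _ fun x => Real.rpow_nonneg (hgpos x).le p)]
    exact lintegral_congr fun x => ENNReal.ofReal_rpow_of_pos (hgpos x)
  have hgD : ∫⁻ x, ‖fderiv ℝ g x‖ₑ ^ p = ENNReal.ofReal (∫ x, ‖fderiv ℝ g x‖ ^ p) := by
    rw [ofReal_integral_eq_lintegral_ofReal hgrad (ae_of_all _ fun x => by positivity)]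
    refine lintegral_congr fun x => ?_
    rw [← ENNReal.ofReal_rpow_of_nonneg (norm_nonneg _) hp0.le, ofReal_norm]
  have hN : 0 < ∫ x, g x := by
    rw [← ENNReal.ofReal_pos, ← hgN]
    exact lintegral_pos_of_forall_pos hgm.ennreal_ofReal fun x => ENNReal.ofReal_pos.2 (hgpos x)
  have hD0 : 0 ≤ ∫ x, ‖fderiv ℝ g x‖ ^ p := integral_nonneg fun x => by positivity
  have hX0 : 0 ≤ ∫ x, g x ^ p := integral_nonneg fun x => Real.rpow_nonneg (hgpos x).le p
  have hγ := gammaConst_pos (p := p) hn hq0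
  have hC : 0 < p ^ p * (gammaConst n p q)⁻¹ * (∫ x, g x) ^ (p * q / (n : ℝ)) := by positivity
  have hbound : ∀ D, ∫ x, ‖fderiv ℝ g x‖ ^ p < D → (∫ x, g x ^ p) ^ (1 + q / (n : ℝ)) ≤
      p ^ p * (gammaConst n p q)⁻¹ * (∫ x, g x) ^ (p * q / (n : ℝ)) * D := by
    intro D hD
    have hDpos : 0 < D := hD0.trans_lt hD
    rw [← Real.le_rpow_inv_iff_of_pos hX0 (by positivity) (by positivity),
      ← ENNReal.ofReal_le_ofReal_iff (by positivity), ← hgX]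
    set u : EuclideanSpace ℝ (Fin n) → ℝ≥0∞ := fun y => ENNReal.ofReal (g y)
    have huc : Continuous u := ENNReal.continuous_ofReal.comp hg.continuous
    calc ∫⁻ x, u x ^ p
        ≤ ∫⁻ x, Filter.liminf (fun m : ℕ => mollify (expKernel n (m + 1)) u x ^ p)
            Filter.atTop := by
          refine lintegral_mono fun x => ?_
          have := (ENNReal.orderIsoRpow p hp0).liminf_apply
            (u := fun m : ℕ => mollify (expKernel n (m + 1)) u x) (f := Filter.atTop)
          simp only [ENNReal.orderIsoRpow_apply] at this
          rw [← this]
          gcongr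
          exact le_liminf_mollify_expKernel hn huc x
      _ ≤ Filter.liminf (fun m : ℕ => ∫⁻ x, mollify (expKernel n (m + 1)) u x ^ p)
            Filter.atTop := lintegral_liminf_le fun m =>
          (measurable_mollify measurable_expKernel huc.measurable).pow_const p
      _ ≤ _ := by
          refine Filter.liminf_le_of_frequently_le' (Filter.Frequently.of_forall fun m => ?_)
          exact lintegral_mollify_expKernel_rpow_le hn hpq (by positivity) hg hgpos hN hDpos hgN
            (by rw [hgX]; exact ENNReal.ofReal_ne_top)
            (by rw [hgD]; exact ENNReal.ofReal_le_ofReal hD.le)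
  rw [← div_le_iff₀' hC]
  refine le_of_forall_gt_imp_ge_of_dense fun D hD => ?_
  rw [div_le_iff₀' hC]
  exact hbound D hD
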